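/- Under FP with inertia and fading memory in a common-payoff game with pairwise-distinct terminal payoffs, if (f_t, z_t) ∈ Λ_∞ for some t ∈ ℕ, then lim_{τ→∞} f_τ = (z_t, f_t^{−z_t}) — the strategy profile that plays the moves on the root path to z_t with probability one and agrees with f_t at every information set off this path — and (z_t, f_t^{−z_t}) is a Nash equilibrium of G. -/

import Mathlib

open Classical Filter MeasureTheory
open scoped BigOperators

noncomputable section

/-- A finite extensive-form game (no chance moves): a finite rooted tree with
decision and terminal nodes, moves, information sets and players. -/
structure ExtGame where
  Node : Type
  Move : Type
  Info : Type
  Player : Type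
  nodeFintype : Fintype Node
  nodeDecEq : DecidableEq Node
  moveFintype : Fintype Move
  moveDecEq : DecidableEq Move
  infoFintype : Fintype Info
  infoDecEq : DecidableEq Info
  playerFintype : Fintype Player
  playerDecEq : DecidableEq Player
  root : Node
  /-- the immediate predecessor of a node together with the move leading from it;
  `none` exactly at the root -/
  parentMove : Node → Option (Node × Move)
  /-- depth of a node in the tree (ensures acyclicity) -/
  rank : Node → ℕ
  parentMove_root : parentMove root = none
  eq_root_of_parentMove_eq_none : ∀ n, parentMove n = none → n = root
  rank_succ : ∀ n m a, parentMove n = some (m, a) → rank n = rank m + 1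
  /-- decision nodes; the remaining nodes are terminal -/
  decision : Node → Prop
  /-- the information set containing a (decision) node -/
  info : Node → Info
  /-- the player moving at an information set -/
  player : Info → Player
  /-- the set of moves available at an information set -/
  avail : Info → Finset Move
  avail_nonempty : ∀ h, (avail h).Nonempty
  /-- moves are in bijection with immediate successors -/
  child_exists : ∀ n, decision n → ∀ a ∈ avail (info n), ∃! n', parentMove n' = some (n, a)
  parent_decision : ∀ n' n a, parentMove n' = some (n, a) → decision n ∧ a ∈ avail (info n)
  /-- information sets partition the set of decision nodes -/
  info_surjOn_decision : ∀ h, ∃ n, decision n ∧ info n = h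
  root_decision : decision root
  /-- the information set of the root is the singleton {root} -/
  root_info_singleton : ∀ n, decision n → info n = info root → n = root
  exists_terminal : ∃ n, ¬ decision n

namespace ExtGame

variable (G : ExtGame)

instance : Fintype G.Node := G.nodeFintype
instance : DecidableEq G.Node := G.nodeDecEq
instance : Fintype G.Move := G.moveFintype
instance : DecidableEq G.Move := G.moveDecEq
instance : Fintype G.Info := G.infoFintype
instance : DecidableEq G.Info := G.infoDecEq
instance : Fintype G.Player := G.playerFintype
instance : DecidableEq G.Player := G.playerDecEq

/-- auxiliary, fuel-based computation of the list of (information set, move) pairs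
crossed on the unique path from the root to a node -/
def pathAux : ℕ → G.Node → List (G.Info × G.Move)
  | 0, _ => []
  | fuel + 1, n =>
    match G.parentMove n with
    | none => []
    | some (m, a) => pathAux fuel m ++ [(G.info m, a)]

/-- the list of (information set, move) pairs crossed on the unique path from the
root to a node; since `rank` increases by exactly one along each edge, the fuel
`G.rank n` is always sufficient -/
def pathPairs (n : G.Node) : List (G.Info × G.Move) := G.pathAux (G.rank n) n

/-- `(h, a) ⊑ n` : the path from the root to `n` goes through `h`, taking move `a` -/
def chooses (h : G.Info) (a : G.Move) (n : G.Node) : Prop := (h, a) ∈ G.pathPairs n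

/-- `h ⊑ n` : the path from the root to `n` goes through the information set `h` -/
def visits (h : G.Info) (n : G.Node) : Prop := ∃ a, G.chooses h a n

/-- terminal nodes -/
def terminalSet : Finset G.Node := Finset.univ.filter fun n => ¬ G.decision n

/-- a behavioral strategy profile: a probability distribution on `avail h` for each
information set `h` -/
def IsProfile (g : G.Info → G.Move → ℝ) : Prop :=
  (∀ h a, 0 ≤ g h a) ∧ (∀ h, ∑ a ∈ G.avail h, g h a = 1) ∧ ∀ h a, a ∉ G.avail h → g h a = 0

/-- probability of reaching node `n` under profile `g` -/
def reachProb (g : G.Info → G.Move → ℝ) (n : G.Node) : ℝ :=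
  ((G.pathPairs n).map fun p => g p.1 p.2).prod

/-- expected payoff (for payoff function `u` on terminal nodes) under profile `g` -/
def eu (u : G.Node → ℝ) (g : G.Info → G.Move → ℝ) : ℝ :=
  ∑ z ∈ G.terminalSet, u z * G.reachProb g z

/-- `(a, g^{-h})` : the profile `g` with `g (·|h)` replaced by the point mass at `a` -/
def replace (g : G.Info → G.Move → ℝ) (h : G.Info) (a : G.Move) : G.Info → G.Move → ℝ :=
  fun h' b => if h' = h then (if b = a then 1 else 0) else g h' b

/-- `max_{a ∈ A^h} u(a, g^{-h})` -/
def brMax (u : G.Node → ℝ) (g : G.Info → G.Move → ℝ) (h : G.Info) : ℝ :=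
  ((G.avail h).image fun a => G.eu u (G.replace g h a)).max' ((G.avail_nonempty h).image _)

/-- the move `a` is a (local) best reply at `h` against `g` -/
def IsBR (u : G.Node → ℝ) (g : G.Info → G.Move → ℝ) (h : G.Info) (a : G.Move) : Prop :=
  a ∈ G.avail h ∧ G.eu u (G.replace g h a) = G.brMax u g h

/-- the optimality gap `V_g(h)` of the profile `g` at the information set `h`,
for the payoff function `u` of the player moving at `h` -/
def gap (u : G.Node → ℝ) (g : G.Info → G.Move → ℝ) (h : G.Info) : ℝ :=
  G.brMax u g h - G.eu u g

/-- the experience of player `i` on the path to a node: the information sets of `i`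
crossed and the moves taken there -/
def experience (i : G.Player) (n : G.Node) : List (G.Info × G.Move) :=
  (G.pathPairs n).filter fun p => G.player p.1 = i

/-- perfect recall: two nodes in the same information set give its player identical
experiences -/
def PerfectRecall : Prop :=
  ∀ n m : G.Node, G.decision n → G.decision m → G.info n = G.info m →
    G.experience (G.player (G.info n)) n = G.experience (G.player (G.info n)) m

/-- indicator `I_t(h)` that the information set `h` is visited on the path to `n` -/
def visitInd (h : G.Info) (n : G.Node) : ℝ := if G.visits h n then 1 else 0

/-- indicator `I_t(a)` that the move `a` is chosen at `h` on the path to `n` -/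
def chooseInd (h : G.Info) (a : G.Move) (n : G.Node) : ℝ := if G.chooses h a n then 1 else 0

/-- `#_t(h)` : the number of rounds `1,…,t` in which `h` is visited -/
def visitCount (z : ℕ → G.Node) (t : ℕ) (h : G.Info) : ℝ :=
  ∑ k ∈ Finset.Icc 1 t, G.visitInd h (z k)

/-- The fictitious play process: in round `t = 1,2,…` the play path reaches the
terminal node `z t`; `f t` are the empirical frequencies entering round `t`;
every move made on the realized path is a local best reply against `f t`. -/
structure IsFP (payoff : G.Player → G.Node → ℝ) (f : ℕ → G.Info → G.Move → ℝ)
    (z : ℕ → G.Node) : Prop where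
  profile : ∀ t, 1 ≤ t → G.IsProfile (f t)
  terminal : ∀ t, 1 ≤ t → ¬ G.decision (z t)
  update : ∀ t, 1 ≤ t → ∀ h a,
    f (t + 1) h a = f t h a +
      G.visitInd h (z t) / G.visitCount z t h * (G.chooseInd h a (z t) - f t h a)
  bestReply : ∀ t, 1 ≤ t → ∀ h a, G.chooses h a (z t) →
    G.eu (payoff (G.player h)) (G.replace (f t) h a) = G.brMax (payoff (G.player h)) (f t) h

end ExtGame

namespace ExtGame

/-- the deterministic fading-memory update map `𝔉₁(·, z)`:
`g(a|h) ↦ g(a|h) + ρ I(h)(I(a) − g(a|h))` for the play path reaching `zz` -/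
def fadeStep (G : ExtGame) (ρ : ℝ) (zz : G.Node) (g : G.Info → G.Move → ℝ) :
    G.Info → G.Move → ℝ :=
  fun h a => g h a + ρ * G.visitInd h zz * (G.chooseInd h a zz - g h a)

/-- `(g, zz)` is an `ℓ`-step locked state: every move on the path to `zz` stays a
best reply for `ℓ` further fading-memory updates -/
def LockedUpTo (G : ExtGame) (u : G.Node → ℝ) (ρ : ℝ) (ℓ : ℕ)
    (g : G.Info → G.Move → ℝ) (zz : G.Node) : Prop :=
  ∀ p ∈ G.pathPairs zz, ∀ m : ℕ, 1 ≤ m → m ≤ ℓ →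
    G.IsBR u ((G.fadeStep ρ zz)^[m] g) p.1 p.2

/-- `(g, zz)` is a locked state -/
def Locked (G : ExtGame) (u : G.Node → ℝ) (ρ : ℝ)
    (g : G.Info → G.Move → ℝ) (zz : G.Node) : Prop :=
  ∀ p ∈ G.pathPairs zz, ∀ m : ℕ, 1 ≤ m →
    G.IsBR u ((G.fadeStep ρ zz)^[m] g) p.1 p.2

/-- `u_max := max_{z ∈ Z} |u(z)|` -/
def umax (G : ExtGame) (u : G.Node → ℝ) : ℝ :=
  sSup {x : ℝ | ∃ zz ∈ G.terminalSet, x = |u zz|}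

/-- `Δ_min := min_{z ≠ z̄} |u(z) − u(z̄)|` -/
def dmin (G : ExtGame) (u : G.Node → ℝ) : ℝ :=
  sInf {x : ℝ | ∃ zz ∈ G.terminalSet, ∃ zz' ∈ G.terminalSet, zz ≠ zz' ∧ x = |u zz - u zz'|}

/-- `L_max`: the maximum number of moves on any root-to-terminal path -/
def lmax (G : ExtGame) : ℕ := G.terminalSet.sup fun zz => (G.pathPairs zz).length

/-- the threshold `(1 − Δ_min/(8 u_max))^{1/L_max}` -/
def thr (G : ExtGame) (u : G.Node → ℝ) : ℝ :=
  (1 - G.dmin u / (8 * G.umax u)) ^ ((G.lmax : ℝ)⁻¹)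

/-- `K_max`: the smallest integer with `1 − (1−ρ)^{K+1} ≥ (1 − Δ_min/(8u_max))^{1/L_max}` -/
def Kmax (G : ExtGame) (u : G.Node → ℝ) (ρ : ℝ) : ℕ :=
  sInf {K : ℕ | G.thr u ≤ 1 - (1 - ρ) ^ (K + 1)}

/-- `K_t`: the smallest integer such that `K_t + 1` repetitions of `z_t` push all
empirical frequencies on its path above the threshold -/
def Kt (G : ExtGame) (u : G.Node → ℝ) (ρ : ℝ) (f : ℕ → G.Info → G.Move → ℝ)
    (z : ℕ → G.Node) (t : ℕ) : ℕ :=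
  sInf {K : ℕ | ∀ p ∈ G.pathPairs (z t),
    G.thr u ≤ (1 - ρ) ^ (K + 1) * f t p.1 p.2 + 1 - (1 - ρ) ^ (K + 1)}

/-- `m_t ∈ ℕ∞`: the smallest `m` with `(𝔉_{K_t}(f_t,z_t), z_t) ∉ Λ_{m+1}`
(`⊤` if `(𝔉_{K_t}(f_t,z_t), z_t)` is a locked state) -/
def mt (G : ExtGame) (u : G.Node → ℝ) (ρ : ℝ) (f : ℕ → G.Info → G.Move → ℝ)
    (z : ℕ → G.Node) (t : ℕ) : ℕ∞ :=
  ⨅ (m : ℕ) (_ : ¬ G.LockedUpTo u ρ (m + 1)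
      ((G.fadeStep ρ (z t))^[G.Kt u ρ f z t] (f t)) (z t)), (m : ℕ∞)

/-- the repeat event `E_t = {z_t = z_{t+1} = … = z_{t+K_t}}` -/
def repeatEvent (G : ExtGame) (u : G.Node → ℝ) (ρ : ℝ) (f : ℕ → G.Info → G.Move → ℝ)
    (z : ℕ → G.Node) (t : ℕ) : Prop :=
  ∀ k ≤ G.Kt u ρ f z t, z (t + k) = z t

/-- `s_t := t + K_t + m_t`, the last round of the forced repetitions -/
def st (G : ExtGame) (u : G.Node → ℝ) (ρ : ℝ) (f : ℕ → G.Info → G.Move → ℝ)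
    (z : ℕ → G.Node) (t : ℕ) : ℕ :=
  t + G.Kt u ρ f z t + (G.mt u ρ f z t).toNat

/-- the repeat-lock event `Ē_t` -/
def repeatLockEvent (G : ExtGame) (u : G.Node → ℝ) (ρ : ℝ)
    (f : ℕ → G.Info → G.Move → ℝ) (z : ℕ → G.Node) (t : ℕ) : Prop :=
  if G.mt u ρ f z t = ⊤ then ∀ τ, t ≤ τ → z τ = z t
  else ∀ k ≤ G.Kt u ρ f z t + (G.mt u ρ f z t).toNat, z (t + k) = z t

/-- `Ẑ_{s_t+1}`: the terminal nodes reachable from `z_{s_t}` by deviating at a single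
information set on its path to a strictly improving move while repeating all other
previous moves -/
def devSet (G : ExtGame) (u : G.Node → ℝ) (ρ : ℝ) (f : ℕ → G.Info → G.Move → ℝ)
    (z : ℕ → G.Node) (A : ℕ → G.Info → G.Move) (t : ℕ) : Set G.Node :=
  {z' | ¬ G.decision z' ∧ ∃ hbar abar ahat, (hbar, abar) ∈ G.pathPairs (z (G.st u ρ f z t)) ∧
    ahat ∈ G.avail hbar ∧
    G.eu u (G.replace (f (G.st u ρ f z t + 1)) hbar abar) <
      G.eu u (G.replace (f (G.st u ρ f z t + 1)) hbar ahat) ∧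
    ∀ p ∈ G.pathPairs z', p.2 = if p.1 = hbar then ahat else A (G.st u ρ f z t) p.1}

/-- the repeat-lock-deviate event `Ê_t` -/
def deviateEvent (G : ExtGame) (u : G.Node → ℝ) (ρ : ℝ) (f : ℕ → G.Info → G.Move → ℝ)
    (z : ℕ → G.Node) (A : ℕ → G.Info → G.Move) (t : ℕ) : Prop :=
  G.repeatLockEvent u ρ f z t ∧ z (G.st u ρ f z t + 1) ∈ G.devSet u ρ f z A t

/-- the sequence of rounds `t_0, t_1, …` with `t_{ℓ+1} = t_ℓ + K_{t_ℓ} + m_{t_ℓ} + 1` -/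
def tseq (G : ExtGame) (u : G.Node → ℝ) (ρ : ℝ) (f : ℕ → G.Info → G.Move → ℝ)
    (z : ℕ → G.Node) (t0 : ℕ) : ℕ → ℕ
  | 0 => t0
  | ℓ + 1 => G.st u ρ f z (tseq G u ρ f z t0 ℓ) + 1

/-- A possible trajectory of fictitious play with inertia (parameters `α h ∈ (0,1)`)
and fading memory (parameter `ρ ∈ (0,1)`) in the game `G` with common payoff `u`:
`f t` are the (fading-memory) empirical frequencies, `A t` is the pure profile of
round `t` (the most recent move at every information set), and `z t` is the terminal
node reached in round `t`. -/
structure IsFPInertiaPath (G : ExtGame) (u : G.Node → ℝ) (ρ : ℝ) (α : G.Info → ℝ)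
    (f : ℕ → G.Info → G.Move → ℝ) (A : ℕ → G.Info → G.Move) (z : ℕ → G.Node) :
    Prop where
  rho_mem : ρ ∈ Set.Ioo (0 : ℝ) 1
  alpha_mem : ∀ h, α h ∈ Set.Ioo (0 : ℝ) 1
  profile : ∀ t, 1 ≤ t → G.IsProfile (f t)
  pure_valid : ∀ t, 1 ≤ t → ∀ h, A t h ∈ G.avail h
  terminal : ∀ t, 1 ≤ t → ¬ G.decision (z t)
  outcome : ∀ t, 1 ≤ t → ∀ p ∈ G.pathPairs (z t), A t p.1 = p.2
  update : ∀ t, 1 ≤ t → f (t + 1) = G.fadeStep ρ (z t) (f t)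
  inertia_unreached : ∀ t, 2 ≤ t → ∀ h, ¬ G.visits h (z t) → A t h = A (t - 1) h
  inertia_br : ∀ t, 2 ≤ t → ∀ h, G.visits h (z t) →
    G.IsBR u (f t) h (A (t - 1) h) → A t h = A (t - 1) h
  inertia_switch : ∀ t, 2 ≤ t → ∀ h, G.visits h (z t) →
    ¬ G.IsBR u (f t) h (A (t - 1) h) →
    A t h = A (t - 1) h ∨ G.IsBR u (f t) h (A t h)

end ExtGame

namespace ExtGame

/-- `(z, g^{−z})`: the profile playing the moves on the path to `zz` with probability
one and agreeing with `g` at all information sets off this path -/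
def pathPointMass (G : ExtGame) (g : G.Info → G.Move → ℝ) (zz : G.Node) :
    G.Info → G.Move → ℝ :=
  fun h a => if G.visits h zz then (if G.chooses h a zz then 1 else 0) else g h a

end ExtGame

namespace ExtGame

lemma pathPairs_of_parentMove {G : ExtGame} {n m : G.Node} {a : G.Move}
    (h : G.parentMove n = some (m, a)) :
    G.pathPairs n = G.pathPairs m ++ [(G.info m, a)] := by
  simp [pathPairs, G.rank_succ n m a h, pathAux, h]

/-- `m` is the immediate predecessor of `n` -/
def IsParent (G : ExtGame) (m n : G.Node) : Prop := ∃ a, G.parentMove n = some (m, a)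

lemma root_reflTransGen (G : ExtGame) (n : G.Node) :
    Relation.ReflTransGen G.IsParent G.root n := by
  induction hk : G.rank n generalizing n with
  | zero =>
    cases hp : G.parentMove n with
    | none => rw [G.eq_root_of_parentMove_eq_none n hp]
    | some p => have := G.rank_succ n p.1 p.2 hp; omega
  | succ k ih =>
    cases hp : G.parentMove n with
    | none => rw [G.eq_root_of_parentMove_eq_none n hp]
    | some p =>
      have := G.rank_succ n p.1 p.2 hp
      exact (ih p.1 (by omega)).tail ⟨p.2, hp⟩

lemma pathPairs_prefix {G : ExtGame} {m n : G.Node}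
    (h : Relation.ReflTransGen G.IsParent m n) : G.pathPairs m <+: G.pathPairs n := by
  induction h with
  | refl => exact List.prefix_rfl
  | tail _ hp ih =>
    obtain ⟨a, ha⟩ := hp
    rw [pathPairs_of_parentMove ha]
    exact ih.trans (List.prefix_append _ _)

lemma chooses_of_parentMove {G : ExtGame} {m n z : G.Node} {a : G.Move}
    (hp : G.parentMove n = some (m, a)) (h : Relation.ReflTransGen G.IsParent n z) :
    G.chooses (G.info m) a z :=
  (pathPairs_prefix h).subset (by simp [pathPairs_of_parentMove hp])

lemma exists_child_of_decision {G : ExtGame} {m z : G.Node} (hz : ¬ G.decision z)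
    (hm : G.decision m) (h : Relation.ReflTransGen G.IsParent m z) :
    ∃ n a, G.parentMove n = some (m, a) ∧ Relation.ReflTransGen G.IsParent n z := by
  rcases h.cases_head with rfl | ⟨n, ⟨a, ha⟩, hn⟩
  · exact absurd hm hz
  · exact ⟨n, a, ha, hn⟩

/-- Two terminal nodes whose paths never choose differently at a common information set
coincide. -/
lemma terminal_eq_of_agree {G : ExtGame} {z z' : G.Node} (hz : ¬ G.decision z)
    (hz' : ¬ G.decision z')
    (hagree : ∀ h a b, G.chooses h a z → G.chooses h b z' → a = b) : z' = z := by
  have anc : ∀ n, Relation.ReflTransGen G.IsParent G.root n →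
      Relation.ReflTransGen G.IsParent n z' → Relation.ReflTransGen G.IsParent n z := by
    intro n hn
    induction hn with
    | refl => exact fun _ => G.root_reflTransGen z
    | @tail m n _ hp ih =>
      intro hnz'
      have hmz := ih (hnz'.head hp)
      obtain ⟨a, ha⟩ := hp
      obtain ⟨hm, hav⟩ := G.parent_decision n m a ha
      obtain ⟨c, b, hb, hcz⟩ := exists_child_of_decision hz hm hmz
      have hab := hagree _ _ _ (chooses_of_parentMove hb hcz) (chooses_of_parentMove ha hnz')
      subst hab
      rwa [(G.child_exists m hm b hav).unique ha hb]
  rcases (anc z' (G.root_reflTransGen z') .refl).cases_head with h | ⟨n, ⟨a, ha⟩, -⟩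
  · exact h
  · exact absurd (G.parent_decision _ _ _ ha).1 hz'

/-- A profile playing the path to `z` for sure yields the payoff of `z`. -/
lemma eu_eq_of_plays_path {G : ExtGame} (u : G.Node → ℝ) {g : G.Info → G.Move → ℝ} {z : G.Node}
    (hz : ¬ G.decision z) (huniq : ∀ h a b, G.chooses h a z → G.chooses h b z → a = b)
    (hg : ∀ h, G.visits h z → ∀ a, g h a = if G.chooses h a z then 1 else 0) :
    G.eu u g = u z := by
  have hzmem : z ∈ G.terminalSet := by simp [terminalSet, hz]
  have hreach : G.reachProb g z = 1 := by
    refine List.prod_eq_one fun x hx => ?_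
    obtain ⟨p, hp, rfl⟩ := List.mem_map.1 hx
    have hc : G.chooses p.1 p.2 z := hp
    rw [hg p.1 ⟨p.2, hc⟩ p.2, if_pos hc]
  rw [eu, Finset.sum_eq_single_of_mem z hzmem, hreach, mul_one]
  intro z' hz' hne
  have hz'' : ¬ G.decision z' := by simpa [terminalSet] using hz'
  have : ∃ h a b, G.chooses h a z ∧ G.chooses h b z' ∧ a ≠ b := by
    by_contra! hcon
    exact hne (terminal_eq_of_agree hz hz'' fun h a b ha hb => hcon h a b ha hb)
  obtain ⟨h, a, b, ha, hb, hab⟩ := this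
  have hzero : G.reachProb g z' = 0 := by
    refine List.prod_eq_zero (List.mem_map.2 ⟨(h, b), hb, ?_⟩)
    exact (hg h ⟨a, ha⟩ b).trans (if_neg fun hc => hab (huniq h a b ha hc))
  rw [hzero, mul_zero]

lemma continuous_eu (G : ExtGame) (u : G.Node → ℝ) : Continuous (G.eu u) := by
  refine continuous_finsetSum _ fun z _ => continuous_const.mul ?_
  exact continuous_list_prod _ fun p _ => by fun_prop

lemma continuous_replace (G : ExtGame) (h : G.Info) (a : G.Move) :
    Continuous fun g => G.replace g h a := by
  refine continuous_pi fun h' => continuous_pi fun b => ?_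
  unfold replace
  split_ifs <;> fun_prop

lemma eu_replace_le_brMax {G : ExtGame} (u : G.Node → ℝ) (g : G.Info → G.Move → ℝ) {h : G.Info}
    {a : G.Move} (ha : a ∈ G.avail h) : G.eu u (G.replace g h a) ≤ G.brMax u g h :=
  Finset.le_max' _ _ (Finset.mem_image_of_mem (fun b => G.eu u (G.replace g h b)) ha)

lemma brMax_le {G : ExtGame} {u : G.Node → ℝ} {g : G.Info → G.Move → ℝ} {h : G.Info} {c : ℝ}
    (hc : ∀ a ∈ G.avail h, G.eu u (G.replace g h a) ≤ c) : G.brMax u g h ≤ c := by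
  refine Finset.max'_le _ _ _ fun x hx => ?_
  obtain ⟨a, ha, rfl⟩ := Finset.mem_image.1 hx
  exact hc a ha

lemma IsBR.of_tendsto {G : ExtGame} {u : G.Node → ℝ} {g : ℕ → G.Info → G.Move → ℝ}
    {g' : G.Info → G.Move → ℝ} {h : G.Info} {a : G.Move} (hg : Tendsto g atTop (nhds g'))
    (ha : ∀ᶠ m in atTop, G.IsBR u (g m) h a) : G.IsBR u g' h a := by
  have hav : a ∈ G.avail h := ha.exists.choose_spec.1
  refine ⟨hav, le_antisymm (eu_replace_le_brMax u g' hav) (brMax_le fun b hb => ?_)⟩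
  have lim : ∀ c, Tendsto (fun m => G.eu u (G.replace (g m) h c)) atTop
      (nhds (G.eu u (G.replace g' h c))) := fun c =>
    (((G.continuous_eu u).comp (G.continuous_replace h c)).tendsto g').comp hg
  refine le_of_tendsto_of_tendsto (lim b) (lim a) ?_
  filter_upwards [ha] with m hm
  exact (eu_replace_le_brMax u (g m) hb).trans hm.2.ge

lemma fadeStep_iterate_sub (G : ExtGame) (ρ : ℝ) (z : G.Node) (g : G.Info → G.Move → ℝ)
    (m : ℕ) (h : G.Info) (a : G.Move) :
    (G.fadeStep ρ z)^[m] g h a - G.pathPointMass g z h a =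
      (1 - ρ) ^ m * (g h a - G.pathPointMass g z h a) := by
  by_cases hv : G.visits h z
  · induction m with
    | zero => simp
    | succ m ih =>
      rw [Function.iterate_succ_apply', pow_succ', mul_assoc, ← ih]
      simp only [fadeStep, pathPointMass, visitInd, chooseInd, if_pos hv]
      ring
  · induction m with
    | zero => simp
    | succ m ih =>
      simp only [pathPointMass, if_neg hv, sub_self, mul_zero] at ih ⊢
      rw [Function.iterate_succ_apply']
      simpa [fadeStep, visitInd, hv] using ih

lemma tendsto_fadeStep_iterate {G : ExtGame} {ρ : ℝ} (hρ : ρ ∈ Set.Ioo (0 : ℝ) 1) (z : G.Node)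
    (g : G.Info → G.Move → ℝ) :
    Tendsto (fun m => (G.fadeStep ρ z)^[m] g) atTop (nhds (G.pathPointMass g z)) := by
  refine tendsto_pi_nhds.2 fun h => tendsto_pi_nhds.2 fun a => ?_
  rw [← tendsto_sub_nhds_zero_iff]
  simp only [fadeStep_iterate_sub]
  simpa using (tendsto_pow_atTop_nhds_zero_of_lt_one (sub_nonneg.2 hρ.2.le)
    (sub_lt_self 1 hρ.1)).mul_const (g h a - G.pathPointMass g z h a)

lemma isProfile_pathPointMass {G : ExtGame} {g : G.Info → G.Move → ℝ} {z : G.Node}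
    (hg : G.IsProfile g) (hav : ∀ h a, G.chooses h a z → a ∈ G.avail h)
    (huniq : ∀ h a b, G.chooses h a z → G.chooses h b z → a = b) :
    G.IsProfile (G.pathPointMass g z) := by
  refine ⟨fun h a => ?_, fun h => ?_, fun h a ha => ?_⟩
  · unfold pathPointMass
    split_ifs
    exacts [zero_le_one, le_rfl, hg.1 h a]
  · by_cases hv : G.visits h z
    · obtain ⟨a, ha⟩ := hv
      rw [Finset.sum_eq_single_of_mem a (hav h a ha)]
      · simp [pathPointMass, show G.visits h z from ⟨a, ha⟩, ha]
      · intro b _ hb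
        have : ¬ G.chooses h b z := fun hc => hb (huniq h b a hc ha)
        simp [pathPointMass, show G.visits h z from ⟨a, ha⟩, this]
    · simpa [pathPointMass, hv] using hg.2.1 h
  · have : ¬ G.chooses h a z := fun hc => ha (hav h a hc)
    simp [pathPointMass, this, hg.2.2 h a ha]

/-- From a locked state on, the same terminal node is reached forever. -/
lemma IsFPInertiaPath.repeat_of_locked {G : ExtGame} {u : G.Node → ℝ} {ρ : ℝ} {α : G.Info → ℝ}
    {f : ℕ → G.Info → G.Move → ℝ} {A : ℕ → G.Info → G.Move} {z : ℕ → G.Node}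
    (hFP : G.IsFPInertiaPath u ρ α f A z) {t : ℕ} (ht : 1 ≤ t)
    (hlock : G.Locked u ρ (f t) (z t)) (m : ℕ) :
    z (t + m) = z t ∧ f (t + m) = (G.fadeStep ρ (z t))^[m] (f t) := by
  induction m with
  | zero => simp
  | succ m ih =>
    obtain ⟨hz, hf⟩ := ih
    have hf' : f (t + (m + 1)) = (G.fadeStep ρ (z t))^[m + 1] (f t) := by
      rw [Function.iterate_succ_apply', ← hf, ← add_assoc, hFP.update (t + m) (by omega), hz]
    refine ⟨?_, hf'⟩
    refine terminal_eq_of_agree (hFP.terminal t ht) (hFP.terminal _ (by omega)) ?_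
    intro h a b ha hb
    have hA : A (t + m) h = a := hFP.outcome (t + m) (by omega) (h, a) (by rw [hz]; exact ha)
    have hbr : G.IsBR u (f (t + (m + 1))) h a := by
      rw [hf']
      exact hlock (h, a) ha (m + 1) (by omega)
    have hA' : A (t + (m + 1)) h = A (t + m) h :=
      hFP.inertia_br (t + (m + 1)) (by omega) h ⟨b, hb⟩ (by
        rw [show t + (m + 1) - 1 = t + m by omega, hA]
        exact hbr)
    rw [← hA, ← hA']
    exact hFP.outcome (t + (m + 1)) (by omega) (h, b) hb

end ExtGame

open ExtGame

/-- **Lemma 6.** Under FP with inertia and fading memory in a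
common-payoff game with pairwise-distinct terminal payoffs, if `(f_t, z_t)` is a
locked state for some round `t`, then `f_τ → (z_t, f_t^{−z_t})` as `τ → ∞`, and
`(z_t, f_t^{−z_t})` is a Nash equilibrium of the stage game. -/
theorem fp_inertia_locked_limit_is_equilibrium (G : ExtGame)
    (u : G.Node → ℝ) (hPR : G.PerfectRecall)
    (hdistinct : ∀ zz zz' : G.Node, ¬ G.decision zz → ¬ G.decision zz' →
      u zz = u zz' → zz = zz')
    (ρ : ℝ) (α : G.Info → ℝ)
    (f : ℕ → G.Info → G.Move → ℝ) (A : ℕ → G.Info → G.Move) (z : ℕ → G.Node)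
    (hFP : G.IsFPInertiaPath u ρ α f A z)
    (t : ℕ) (ht : 1 ≤ t)
    (hlock : G.Locked u ρ (f t) (z t)) :
    Filter.Tendsto (fun τ => f τ) Filter.atTop (nhds (G.pathPointMass (f t) (z t))) ∧
      G.IsProfile (G.pathPointMass (f t) (z t)) ∧
      ∀ h : G.Info, G.gap u (G.pathPointMass (f t) (z t)) h = 0 := by
  have hzt := hFP.terminal t ht
  have hout : ∀ h a, G.chooses h a (z t) → A t h = a := fun h a ha => hFP.outcome t ht (h, a) ha
  have huniq : ∀ h a b, G.chooses h a (z t) → G.chooses h b (z t) → a = b := fun h a b ha hb =>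
    (hout h a ha).symm.trans (hout h b hb)
  have hlim := tendsto_fadeStep_iterate hFP.rho_mem (z t) (f t)
  refine ⟨?_, isProfile_pathPointMass (hFP.profile t ht)
    (fun h a ha => hout h a ha ▸ hFP.pure_valid t ht h) huniq, fun h => sub_eq_zero.2 ?_⟩
  · refine (tendsto_add_atTop_iff_nat t).1 (hlim.congr fun m => ?_)
    rw [add_comm m t, (hFP.repeat_of_locked ht hlock m).2]
  · have hvis : ∀ h, G.visits h (z t) → ∀ a,
        G.pathPointMass (f t) (z t) h a = if G.chooses h a (z t) then 1 else 0 :=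
      fun h hv a => if_pos hv
    by_cases hv : G.visits h (z t)
    · obtain ⟨a, ha⟩ := hv
      have hbr : G.IsBR u (G.pathPointMass (f t) (z t)) h a :=
        .of_tendsto hlim ((eventually_ge_atTop 1).mono fun m hm => hlock (h, a) ha m hm)
      rw [← hbr.2]
      congr 1
      funext h' b
      by_cases hh : h' = h
      · subst hh
        have : b = a ↔ G.chooses h' b (z t) := ⟨fun e => e ▸ ha, fun hb => huniq h' b a hb ha⟩
        simp [replace, hvis h' ⟨a, ha⟩, this]
      · simp [replace, hh]
    · have hdev : ∀ b, G.eu u (G.replace (G.pathPointMass (f t) (z t)) h b) = u (z t) := by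
        refine fun b => eu_eq_of_plays_path u hzt huniq fun h' hv' a => ?_
        have hh : h' ≠ h := fun e => hv (e ▸ hv')
        simp [replace, hh, hvis h' hv']
      rw [eu_eq_of_plays_path u hzt huniq hvis]
      obtain ⟨b, hb⟩ := G.avail_nonempty h
      exact le_antisymm (brMax_le fun c _ => (hdev c).le)
        ((hdev b).ge.trans (eu_replace_le_brMax u _ hb))
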